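/- Let Λ = {u : ρ(u) ≤ ρ(F(x⁰))}, assume Λ is bounded, ρ ≥ 0, and suppose each search direction dᵛ satisfies ρ(F(xᵛ) + F'(xᵛ)dᵛ) + (1/2)(dᵛ)ᵀU(xᵛ)dᵛ ≤ ρ(F(xᵛ)) ≤ ρ(F(x⁰)). If additionally there is λ_min > 0 with dᵀU(x)d ≥ λ_min‖d‖² for all d in the null space of F'(x) for every x in the (compact) set F⁻¹(Λ), and xᵛ → x̄ along a subsequence with dᵛ/‖dᵛ‖ → u for a unit vector u while ‖dᵛ‖ → ∞, then F'(x̄)u = 0 and uᵀU(x̄)u ≥ λ_min, contradicting (dᵛ)ᵀU(xᵛ)dᵛ ≤ 2ρ(F(x⁰)) which forces uᵀU(x̄)u ≤ 0. Hence the search directions {dᵛ} are bounded. -/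

import Mathlib

open Matrix Set

/-- Boundedness of Gauss-Newton search directions under a null-space curvature
condition (Corollary on global convergence). -/
theorem search_directions_bounded
    (n p : ℕ)
    (ρ : (Fin p → ℝ) → ℝ) (hρconv : ConvexOn ℝ Set.univ ρ)
    (hρnonneg : ∀ u, 0 ≤ ρ u)
    (F : (Fin n → ℝ) → (Fin p → ℝ)) (hF : ContDiff ℝ 1 F)
    (U : (Fin n → ℝ) → Matrix (Fin n) (Fin n) ℝ)
    (hUcont : Continuous U) (hUpsd : ∀ x, (U x).PosSemidef)
    (x0 : Fin n → ℝ)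
    (Λ : Set (Fin p → ℝ)) (hΛ : Λ = {u | ρ u ≤ ρ (F x0)})
    (hΛbdd : Bornology.IsBounded Λ)
    (hcompact : IsCompact (F ⁻¹' Λ))
    (x : ℕ → (Fin n → ℝ)) (d : ℕ → (Fin n → ℝ))
    (hx : ∀ ν, x ν ∈ F ⁻¹' Λ)
    (hdir : ∀ ν, ρ (F (x ν) + (fderiv ℝ F (x ν)) (d ν))
        + (1 / 2) * (d ν ⬝ᵥ (U (x ν) *ᵥ d ν)) ≤ ρ (F (x ν)))
    (hmono : ∀ ν, ρ (F (x ν)) ≤ ρ (F x0))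
    (lmin : ℝ) (hlmin : 0 < lmin)
    (hnull : ∀ y ∈ F ⁻¹' Λ, ∀ v : Fin n → ℝ,
      (fderiv ℝ F y) v = 0 → lmin * ‖v‖ ^ 2 ≤ v ⬝ᵥ (U y *ᵥ v)) :
    ∃ M : ℝ, ∀ ν, ‖d ν‖ ≤ M := by
  have hfd : Continuous (fderiv ℝ F) := hF.continuous_fderiv (by norm_num)
  have hg : Continuous (fun q : (Fin n → ℝ) × (Fin n → ℝ) =>
      ‖(fderiv ℝ F q.1) q.2‖ + q.2 ⬝ᵥ (U q.1 *ᵥ q.2)) := by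
    have h1 : Continuous (fun q : (Fin n → ℝ) × (Fin n → ℝ) => (fderiv ℝ F q.1) q.2) :=
      (hfd.comp continuous_fst).clm_apply continuous_snd
    have h2 : Continuous (fun q : (Fin n → ℝ) × (Fin n → ℝ) => q.2 ⬝ᵥ (U q.1 *ᵥ q.2)) :=
      continuous_snd.dotProduct ((hUcont.comp continuous_fst).matrix_mulVec continuous_snd)
    exact h1.norm.add h2
  have hquad : ∀ y v, 0 ≤ v ⬝ᵥ (U y *ᵥ v) := by
    intro y v
    simpa using (hUpsd y).dotProduct_mulVec_nonneg v
  have hK := hcompact.prod (isCompact_sphere (0 : Fin n → ℝ) 1)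
  obtain ⟨m, hm, hmin⟩ := hK.exists_forall_le' (a := (0 : ℝ)) hg.continuousOn (by
    rintro ⟨y, v⟩ ⟨hy, hv⟩
    have hv1 : ‖v‖ = 1 := by simpa using hv
    by_cases h0 : (fderiv ℝ F y) v = 0
    · have := hnull y hy v h0
      rw [hv1] at this
      simp only [h0, norm_zero]
      linarith
    · have := norm_pos_iff.mpr h0
      have := hquad y v
      simp only
      linarith)
  obtain ⟨B, hB⟩ := hΛbdd.exists_norm_le
  set R := ρ (F x0) with hR
  refine ⟨max 1 ((2 * B + 2 * R) / m), fun ν => ?_⟩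
  rcases le_total ‖d ν‖ 1 with h1 | h1
  · exact h1.trans (le_max_left _ _)
  refine le_trans ?_ (le_max_right _ _)
  have ht : 0 < ‖d ν‖ := by linarith
  have hq := hquad (x ν) (d ν)
  have hA : ‖(fderiv ℝ F (x ν)) (d ν)‖ ≤ 2 * B := by
    have ha := hB _ (hx ν)
    have hb : ‖F (x ν) + (fderiv ℝ F (x ν)) (d ν)‖ ≤ B := by
      apply hB
      rw [hΛ]
      show ρ _ ≤ R
      linarith [hdir ν, hmono ν]
    have : (fderiv ℝ F (x ν)) (d ν) =
        (F (x ν) + (fderiv ℝ F (x ν)) (d ν)) - F (x ν) := by abel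
    rw [this]
    exact (norm_sub_le _ _).trans (by linarith)
  have hQ : d ν ⬝ᵥ (U (x ν) *ᵥ d ν) ≤ 2 * R := by
    linarith [hdir ν, hmono ν, hρnonneg (F (x ν) + (fderiv ℝ F (x ν)) (d ν))]
  have hmm := hmin (x ν, ‖d ν‖⁻¹ • d ν) ⟨hx ν, by
    simp [norm_smul, ht.ne']⟩
  simp only [map_smul, norm_smul, norm_inv, norm_norm, mulVec_smul, smul_dotProduct,
    dotProduct_smul, smul_eq_mul] at hmm
  have hi : ‖d ν‖⁻¹ ≤ 1 := inv_le_one_of_one_le₀ h1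
  have hi0 : 0 < ‖d ν‖⁻¹ := inv_pos.mpr ht
  have h3 : ‖d ν‖⁻¹ * (d ν ⬝ᵥ (U (x ν) *ᵥ d ν)) ≤ 2 * R := by nlinarith
  have h4 : m ≤ ‖d ν‖⁻¹ * (2 * B + 2 * R) := by
    refine hmm.trans ?_
    rw [← mul_add]
    exact mul_le_mul_of_nonneg_left (by linarith) hi0.le
  rw [le_div_iff₀ hm]
  calc ‖d ν‖ * m ≤ ‖d ν‖ * (‖d ν‖⁻¹ * (2 * B + 2 * R)) :=
        mul_le_mul_of_nonneg_left h4 ht.le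
    _ = 2 * B + 2 * R := by rw [← mul_assoc, mul_inv_cancel₀ ht.ne', one_mul]
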